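/- For all integers n₁, n₂, q₁, q₂ and all t ∈ ℕ: [λ·f(q₁,n₁−1,t) + f(q₁,n₁,t)]·[f(q₂,n₂,t) − f(q₂,n₂+1,t)] = [λ·f(q₂−1,n₂−1,t) + f(q₂−1,n₂,t)]·[f(q₁+1,n₁,t) − f(q₁+1,n₁+1,t)]. -/

import Mathlib

open Finset

namespace TASEP

attribute [local instance] Classical.propDecidable

noncomputable section

/-- Generalized binomial coefficient `C(n,k) = n(n-1)⋯(n-k+1)/k!` for `n : ℤ`, `k : ℕ`. -/
def C (n : ℤ) (k : ℕ) : ℝ :=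
  (∏ i ∈ Finset.range k, ((n : ℝ) - (i : ℝ))) / (k.factorial : ℝ)

/-- `λ = v/(1-v)`. -/
def lam (v : ℝ) : ℝ := v / (1 - v)

/-- The matrix element `f(a,b,t)` of the determinant solution of the parallel TASEP. -/
def f (v : ℝ) (a b : ℤ) (t : ℕ) : ℝ :=
  if 1 ≤ a then
    (1 - v) ^ t * (-1 : ℝ) ^ a *
      ∑' k : ℕ, if 0 ≤ b + (k : ℤ) then
        C ((t : ℤ) + a) (b + (k : ℤ)).toNat * C (a + (k : ℤ) - 1) k *
          lam v ^ (b + (k : ℤ)).toNat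
      else 0
  else
    (1 - v) ^ t * (-1 : ℝ) ^ a *
      ∑' j : ℕ, if (j : ℤ) ≤ -a ∧ 0 ≤ b + (j : ℤ) then
        (-1 : ℝ) ^ j * C (-a) j * C ((t : ℤ) + a) (b + (j : ℤ)).toNat *
          lam v ^ (b + (j : ℤ)).toNat
      else 0

/-- Number of pairs of neighboring particles (occupied neighboring sites) in `x`. -/
def nPairs {P : ℕ} (x : Fin P → ℤ) : ℕ :=
  (Finset.univ.filter fun p : Fin P × Fin P =>
    ((p.2 : ℕ) = (p.1 : ℕ) + 1) ∧ x p.2 = x p.1 + 1).card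

/-- Number of clusters `N_c(x) = P - nPairs x`. -/
def Nc {P : ℕ} (x : Fin P → ℤ) : ℕ := P - nPairs x

/-- The matrix `F(X,Y,t)` with entries `f(i-j, x_i - y_j, t)`. -/
def Fmat (v : ℝ) {P : ℕ} (x y : Fin P → ℤ) (t : ℕ) : Matrix (Fin P) (Fin P) ℝ :=
  Matrix.of fun i j => f v ((i : ℤ) - (j : ℤ)) (x i - y j) t

/-- One-step transition probability of the parallel-update TASEP. -/
def Tstep (v : ℝ) {P : ℕ} (x x' : Fin P → ℤ) : ℝ :=
  ∏ i : Fin P,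
    if x i = x' i + 1 ∧ (∀ j : Fin P, (j : ℕ) = (i : ℕ) + 1 → x' i + 1 < x' j) then v
    else if x i = x' i ∧ (∀ j : Fin P, (j : ℕ) = (i : ℕ) + 1 → x' i + 1 < x' j) then 1 - v
    else if x i = x' i ∧ (∃ j : Fin P, (j : ℕ) = (i : ℕ) + 1 ∧ x' j = x' i + 1) then 1
    else 0

/-- Transformed transition probability `T₀(X,X') = (1-v)^(N_c(X)-N_c(X')) T(X,X')`. -/
def T0 (v : ℝ) {P : ℕ} (x x' : Fin P → ℤ) : ℝ :=
  (1 - v) ^ ((Nc x : ℤ) - (Nc x' : ℤ)) * Tstep v x x'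

/-- `shiftBy x k` subtracts `1` from the coordinates selected by `k`. -/
def shiftBy {P : ℕ} (x : Fin P → ℤ) (k : Fin P → Bool) : Fin P → ℤ :=
  fun i => x i - if k i then 1 else 0

/-- `t`-step probability of the parallel-update TASEP started from `x0`. -/
def Pt (v : ℝ) {P : ℕ} (x0 : Fin P → ℤ) : ℕ → (Fin P → ℤ) → ℝ
  | 0 => fun x => if x = x0 then 1 else 0
  | t + 1 => fun x => ∑ k : Fin P → Bool,
      if StrictMono (shiftBy x k) then
        Tstep v x (shiftBy x k) * Pt v x0 t (shiftBy x k)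
      else 0

/-- One-particle weight `F₀(x|t)`. -/
def F0 (v : ℝ) (x : ℤ) (t : ℕ) : ℝ :=
  if 0 ≤ x ∧ x ≤ (t : ℤ) then (t.choose x.toNat : ℝ) * v ^ x.toNat * (1 - v) ^ (t - x.toNat)
  else 0

/-- Schütz's functions `F_m(N|t)` for the backward sequential update. -/
def Fm (v : ℝ) (m : ℤ) (N : ℤ) (t : ℕ) : ℝ :=
  if 0 < m then
    ∑' k : ℕ, ((k + m.toNat - 1).choose (m.toNat - 1) : ℝ) * F0 v (N + (k : ℤ)) t
  else if m = 0 then F0 v N t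
  else
    ∑ k ∈ Finset.range (m.natAbs + 1),
      (-1 : ℝ) ^ k * (m.natAbs.choose k : ℝ) * F0 v (N + (k : ℤ)) t

/-- The functions `F̃_m(N|t)` for the parallel update. -/
def Ftil (v : ℝ) (m : ℤ) (N : ℤ) (t : ℕ) : ℝ :=
  if 0 < m then
    ∑ n ∈ Finset.range (m.toNat + 1),
      ∑' k : ℤ, if -(n : ℤ) ≤ k then
        (m.toNat.choose n : ℝ) * ((m + (n : ℤ) + k - 1).toNat.choose ((n : ℤ) + k).toNat : ℝ) *
          lam v ^ n * F0 v (N + k) t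
      else 0
  else if m = 0 then F0 v N t
  else
    ∑ n ∈ Finset.range (m.natAbs + 1),
      ∑' k : ℤ, if -(n : ℤ) ≤ k then
        (-1 : ℝ) ^ n * (m.natAbs.choose n : ℝ) *
          (((m.natAbs : ℤ) + (n : ℤ) + k - 1).toNat.choose ((n : ℤ) + k).toNat : ℝ) *
          (-(lam v)) ^ ((n : ℤ) + k).toNat * F0 v (N - k) t
      else 0

/-- One-step transition probability of the TASEP with backward sequential update. -/
def TBw (v : ℝ) {P : ℕ} (x x' : Fin P → ℤ) : ℝ :=
  ∏ i : Fin P,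
    if h : (i : ℕ) + 1 < P then
      if x' i + 1 < x' ⟨(i : ℕ) + 1, h⟩ ∨
          (x' ⟨(i : ℕ) + 1, h⟩ = x' i + 1 ∧ x ⟨(i : ℕ) + 1, h⟩ = x' ⟨(i : ℕ) + 1, h⟩ + 1) then
        (if x i = x' i + 1 then v else if x i = x' i then 1 - v else 0)
      else if x' ⟨(i : ℕ) + 1, h⟩ = x' i + 1 ∧ x ⟨(i : ℕ) + 1, h⟩ = x' ⟨(i : ℕ) + 1, h⟩ then
        (if x i = x' i then 1 else 0)
      else 0
    else
      (if x i = x' i + 1 then v else if x i = x' i then 1 - v else 0)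

/-- `t`-step probability of the backward-sequential-update TASEP started from `x0`. -/
def Pbw (v : ℝ) {P : ℕ} (x0 : Fin P → ℤ) : ℕ → (Fin P → ℤ) → ℝ
  | 0 => fun x => if x = x0 then 1 else 0
  | t + 1 => fun x => ∑ k : Fin P → Bool,
      if StrictMono (shiftBy x k) then
        TBw v x (shiftBy x k) * Pbw v x0 t (shiftBy x k)
      else 0

/-- Reversed-negated configuration `ι(X)_i = -x_{P+1-i}`. -/
def iota {P : ℕ} (x : Fin P → ℤ) : Fin P → ℤ := fun i => - x i.rev

/-- `i` is a cluster head of `x` (first particle of a cluster). -/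
def isHead {P : ℕ} (x : Fin P → ℤ) (i : Fin P) : Prop :=
  ∀ j : Fin P, (i : ℕ) = (j : ℕ) + 1 → x j + 1 < x i

/-- Position of the `i`-th walker at time `s`, given steps `ε`. -/
def walkerPos {P t : ℕ} (x0 : Fin P → ℤ) (ε : Fin P → Fin t → Bool) (i : Fin P) (s : ℕ) : ℤ :=
  x0 i + ((Finset.univ.filter fun u : Fin t => (u : ℕ) < s ∧ ε i u = true).card : ℤ)

/-- General Bethe-ansatz sum with amplitudes `A`. -/
def betheSum {P : ℕ} (z : Fin P → ℂ) (A : Equiv.Perm (Fin P) → ℂ) (x : Fin P → ℤ) : ℂ :=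
  ∑ σ : Equiv.Perm (Fin P), A σ * ∏ i : Fin P, z (σ i) ^ (-(x i))

/-- `ξ(z) = -(1+λz)/(1-1/z)`. -/
def xiC (v : ℝ) (z : ℂ) : ℂ := -(1 + (lam v : ℂ) * z) / (1 - 1 / z)

/-- Bethe amplitudes `A_σ = sgn(σ) ∏ ξ_{σ(i)}^{i-σ(i)}`. -/
def ampA (v : ℝ) {P : ℕ} (z : Fin P → ℂ) (σ : Equiv.Perm (Fin P)) : ℂ :=
  ((Equiv.Perm.sign σ : ℤ) : ℂ) * ∏ i : Fin P, xiC v (z (σ i)) ^ ((i : ℤ) - (σ i : ℤ))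

/-- The Bethe eigenfunction `B(x)`. -/
def betheB (v : ℝ) {P : ℕ} (z : Fin P → ℂ) (x : Fin P → ℤ) : ℂ :=
  betheSum z (ampA v z) x


theorem C_succ_succ (n : ℤ) (k : ℕ) : C (n + 1) (k + 1) = C n k + C n (k + 1) := by
  have hprod : ∏ i ∈ range (k + 1), (((n + 1 : ℤ) : ℝ) - (i : ℝ)) =
      ((n : ℝ) + 1) * ∏ i ∈ range k, ((n : ℝ) - (i : ℝ)) := by
    rw [prod_range_succ', mul_comm]
    congr 1
    · push_cast; ring
    · exact prod_congr rfl fun i _ => by push_cast; ring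
  unfold C
  rw [hprod, prod_range_succ, Nat.factorial_succ]
  have hk : (k.factorial : ℝ) ≠ 0 := by positivity
  have hk' : (k : ℝ) + 1 ≠ 0 := by positivity
  push_cast
  field_simp
  ring

theorem C_zero_right (n : ℤ) : C n 0 = 1 := by simp [C]

theorem C_eq_zero_of_lt {n : ℤ} {k : ℕ} (hn : 0 ≤ n) (hk : n < k) : C n k = 0 := by
  lift n to ℕ using hn
  rw [C, prod_eq_zero (i := n) (by simpa using hk) (by simp), zero_div]

theorem C_add_sub_one (a : ℤ) (k : ℕ) : C (a + k - 1) k = (-1) ^ k * C (-a) k := by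
  have hneg : (-1 : ℝ) ^ k = ∏ _i ∈ range k, (-1 : ℝ) := by simp
  rw [C, C, ← mul_div_assoc, hneg, ← prod_mul_distrib, ← prod_range_reflect]
  congr 1
  refine prod_congr rfl fun i hi => ?_
  have hcast : ((k - 1 - i : ℕ) : ℝ) = k - 1 - i := by
    have := mem_range.1 hi
    rw [Nat.cast_sub (by omega), Nat.cast_sub (by omega)]
    simp
  rw [hcast]
  push_cast
  ring

/-- The coefficient of `z ^ m` in the power series `(1 + x z) ^ n`. -/
def binomCoeff (x : ℝ) (n m : ℤ) : ℝ :=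
  if 0 ≤ m then C n m.toNat * x ^ m.toNat else 0

theorem binomCoeff_succ (x : ℝ) (n m : ℤ) :
    binomCoeff x (n + 1) m = x * binomCoeff x n (m - 1) + binomCoeff x n m := by
  unfold binomCoeff
  rcases lt_trichotomy m 0 with hm | rfl | hm
  · rw [if_neg (by omega), if_neg (by omega), if_neg (by omega)]
    simp
  · simp [C_zero_right]
  · obtain ⟨k, rfl⟩ : ∃ k : ℕ, m = k + 1 := ⟨(m - 1).toNat, by omega⟩
    rw [if_pos (by omega), if_pos (by omega), if_pos (by omega),
      show ((k : ℤ) + 1).toNat = k + 1 by omega, show ((k : ℤ) + 1 - 1).toNat = k by omega,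
      C_succ_succ]
    ring

theorem binomCoeff_eq_zero_of_lt (x : ℝ) {n m : ℤ} (hn : 0 ≤ n) (hm : n < m) :
    binomCoeff x n m = 0 := by
  rw [binomCoeff, if_pos (by omega), C_eq_zero_of_lt hn (by omega), zero_mul]

theorem neg_one_pow_mul_C_neg (a : ℤ) (k : ℕ) :
    (-1) ^ (k + 1) * C (-a) (k + 1) =
      (-1) ^ (k + 1) * C (-(a + 1)) (k + 1) - (-1) ^ k * C (-(a + 1)) k := by
  rw [show -a = -(a + 1) + 1 by ring, C_succ_succ]
  ring

/-- The coefficient of `z ^ b` in `(1 + x z) ^ n (1 - z⁻¹) ^ (-a)`. -/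
def laurentCoeff (x : ℝ) (n a b : ℤ) : ℝ :=
  ∑' k : ℕ, binomCoeff x n (b + k) * ((-1) ^ k * C (-a) k)

theorem summable_laurentCoeff (x : ℝ) {n a : ℤ} (h : 0 ≤ n ∨ a ≤ 0) (b : ℤ) :
    Summable fun k : ℕ => binomCoeff x n (b + k) * ((-1) ^ k * C (-a) k) := by
  refine summable_of_ne_finset_zero (s := range ((n - b).toNat + (-a).toNat + 1)) fun k hk => ?_
  rw [mem_range, not_lt] at hk
  rcases h with h | h
  · rw [binomCoeff_eq_zero_of_lt x h (by omega), zero_mul]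
  · rw [C_eq_zero_of_lt (n := -a) (by omega) (by omega), mul_zero, mul_zero]

theorem laurentCoeff_succ_left (x : ℝ) {n a : ℤ} (h : 0 ≤ n ∨ a ≤ 0) (b : ℤ) :
    laurentCoeff x (n + 1) a b = x * laurentCoeff x n a (b - 1) + laurentCoeff x n a b := by
  unfold laurentCoeff
  rw [← tsum_mul_left, ← ((summable_laurentCoeff x h (b - 1)).mul_left x).tsum_add
    (summable_laurentCoeff x h b)]
  refine tsum_congr fun k => ?_
  rw [binomCoeff_succ, show b + (k : ℤ) - 1 = b - 1 + k by ring]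
  ring

theorem laurentCoeff_sub_succ (x : ℝ) {n a : ℤ} (h : 0 ≤ n ∨ a + 1 ≤ 0) (b : ℤ) :
    laurentCoeff x n (a + 1) b - laurentCoeff x n (a + 1) (b + 1) = laurentCoeff x n a b := by
  have hb := summable_laurentCoeff x h b
  have ha : Summable fun k : ℕ => binomCoeff x n (b + k) * ((-1) ^ k * C (-a) k) :=
    summable_laurentCoeff x (h.imp_right (by omega)) b
  unfold laurentCoeff
  rw [hb.tsum_eq_zero_add, ha.tsum_eq_zero_add, add_sub_assoc,
    ← ((summable_nat_add_iff 1).2 hb).tsum_sub (summable_laurentCoeff x h (b + 1))]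
  congr 1
  refine tsum_congr fun k => ?_
  rw [neg_one_pow_mul_C_neg a k, show b + 1 + (k : ℤ) = b + (k + 1 : ℕ) by push_cast; ring]
  ring

theorem f_eq_laurentCoeff (v : ℝ) (a b : ℤ) (t : ℕ) :
    f v a b t = (1 - v) ^ t * (-1 : ℝ) ^ a * laurentCoeff (lam v) (t + a) a b := by
  unfold f laurentCoeff binomCoeff
  split_ifs with ha
  · congr 1
    refine tsum_congr fun k => ?_
    split_ifs
    · rw [C_add_sub_one]; ring
    · ring
  · congr 1
    refine tsum_congr fun k => ?_
    by_cases hk : (k : ℤ) ≤ -a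
    · by_cases hb : 0 ≤ b + (k : ℤ)
      · rw [if_pos ⟨hk, hb⟩, if_pos hb]; ring
      · rw [if_neg (fun h => hb h.2), if_neg hb, zero_mul]
    · rw [if_neg (fun h => hk h.1), C_eq_zero_of_lt (n := -a) (by omega) (by omega), mul_zero,
        mul_zero]

/-- The linear relation coming from `(1 + λ z) A_a(z) = (1 - z⁻¹) A_{a+1}(z)`, where `A_a` is
the generating function of `f`. -/
theorem lam_mul_f_add_f (v : ℝ) (a b : ℤ) (t : ℕ) :
    lam v * f v a (b - 1) t + f v a b t = -(f v (a + 1) b t - f v (a + 1) (b + 1) t) := by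
  simp only [f_eq_laurentCoeff]
  rw [zpow_add_one₀ (by norm_num), ← add_assoc]
  linear_combination (1 - v) ^ t * (-1 : ℝ) ^ a *
    (-laurentCoeff_succ_left (lam v) (n := t + a) (a := a) (by omega) b -
      laurentCoeff_sub_succ (lam v) (n := t + a + 1) (a := a) (by omega) b)

/-- The bilinear constraint relation for `f`. -/
theorem f_constraint_relation (v : ℝ) (hv0 : 0 < v) (hv1 : v < 1)
    (n1 n2 q1 q2 : ℤ) (t : ℕ) :
    (lam v * f v q1 (n1 - 1) t + f v q1 n1 t) *
        (f v q2 n2 t - f v q2 (n2 + 1) t)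
      = (lam v * f v (q2 - 1) (n2 - 1) t + f v (q2 - 1) n2 t) *
        (f v (q1 + 1) n1 t - f v (q1 + 1) (n1 + 1) t) := by
  have h := lam_mul_f_add_f v (q2 - 1) n2 t
  rw [sub_add_cancel] at h
  rw [h, lam_mul_f_add_f v q1 n1 t]
  ring

end

end TASEP
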